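/- arXiv:1809.06844 — 5 statements merged into one kernel-verified Lean document; each statement's English description precedes it below -/
import Mathlib

section
/- Let N, K, t be integers with K ≥ 2, N ≥ K, and 1 ≤ t ≤ K−1, and define the real number M = N·t/(K−t) + 1/t + 1. Then ((M−1)·K−1)² − 4·K·N ≥ 0 and t = (1 + (M−1)·K + √(((M−1)·K−1)² − 4·K·N)) / (2·(N+M−1)); that is, t is the larger root of the quadratic (N+M−1)·t² − ((M−1)·K+1)·t + K = 0. -/
/-- For integers `K ≥ 2`, `N ≥ K`, `1 ≤ t ≤ K−1` and `M = N·t/(K−t) + 1/t + 1`,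
the discriminant `((M−1)·K−1)² − 4·K·N` is nonnegative and `t` equals the larger
root `(1 + (M−1)·K + √(((M−1)·K−1)² − 4·K·N)) / (2·(N+M−1))` of the quadratic
`(N+M−1)·t² − ((M−1)·K+1)·t + K = 0`. -/
theorem stmt4 (N K t : ℕ) (hK : 2 ≤ K) (hN : K ≤ N) (ht : 1 ≤ t) (htK : t ≤ K - 1)
    (M : ℝ) (hM : M = (N : ℝ) * t / ((K : ℝ) - t) + 1 / t + 1) :
    ((M - 1) * K - 1) ^ 2 - 4 * K * N ≥ 0 ∧
    (t : ℝ) = (1 + (M - 1) * K + Real.sqrt (((M - 1) * K - 1) ^ 2 - 4 * K * N)) /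
      (2 * ((N : ℝ) + M - 1)) := by
  have htR : (1 : ℝ) ≤ t := by exact_mod_cast ht
  have hNK : (K : ℝ) ≤ N := by exact_mod_cast hN
  have hKt : (t : ℝ) + 1 ≤ K := by
    have : t + 1 ≤ K := by omega
    exact_mod_cast this
  have hd : (0 : ℝ) < (K : ℝ) - t := by linarith
  have ht0 : (0 : ℝ) < t := by linarith
  obtain ⟨a, ha⟩ : ∃ a : ℝ, a = (N : ℝ) * t / ((K : ℝ) - t) := ⟨_, rfl⟩
  obtain ⟨b, hb⟩ : ∃ b : ℝ, b = 1 / (t : ℝ) := ⟨_, rfl⟩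
  rw [← ha, ← hb] at hM
  have hb1 : b * t = 1 := by rw [hb]; field_simp
  have ha1 : a * (K - t) = N * t := by rw [ha]; field_simp
  have hN1 : a * (K * b - 1) = N := by
    linear_combination b * ha1 + (N + a) * hb1
  have hab : b ≤ a := by
    rw [ha, hb, div_le_div_iff₀ ht0 hd]
    nlinarith [mul_le_mul hNK (mul_le_mul htR htR (by norm_num) ht0.le) (by norm_num) (by linarith)]
  have hb0 : 0 < b := by rw [hb]; positivity
  have hs : 0 ≤ K * a + 1 - K * b := by nlinarith
  have hD : ((M - 1) * K - 1) ^ 2 - 4 * K * N = (K * a + 1 - K * b) ^ 2 := by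
    rw [hM]; linear_combination 4 * K * hN1
  have hpos : 0 < (N : ℝ) + M - 1 := by rw [hM]; linarith
  refine ⟨by rw [hD]; positivity, ?_⟩
  rw [hD, Real.sqrt_sq hs, eq_div_iff (by positivity), hM]
  linear_combination (-2) * ha1 + 2 * hb1
end

section
/- Let N, K, t be integers with K ≥ 2, N ≥ K, and 1 ≤ t ≤ K−1, and define the real number M = N·t/(K−t) + 1/t + 1. Then the normalized delivery sum rate of the centralized scheme satisfies K/t = 2·K·(N+M−1) / (1 + (M−1)·K + √(((M−1)·K−1)² − 4·K·N)). -/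
/-- For integers `K ≥ 2`, `N ≥ K`, `1 ≤ t ≤ K−1` and `M = N·t/(K−t) + 1/t + 1`,
the normalized delivery sum rate of the centralized scheme satisfies
`K/t = 2·K·(N+M−1) / (1 + (M−1)·K + √(((M−1)·K−1)² − 4·K·N))`. -/
theorem stmt5 (N K t : ℕ) (hK : 2 ≤ K) (hN : K ≤ N) (ht : 1 ≤ t) (htK : t ≤ K - 1)
    (M : ℝ) (hM : M = (N : ℝ) * t / ((K : ℝ) - t) + 1 / t + 1) :
    (K : ℝ) / t = 2 * K * ((N : ℝ) + M - 1) /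
      (1 + (M - 1) * K + Real.sqrt (((M - 1) * K - 1) ^ 2 - 4 * K * N)) := by
  have htK' : t < K := by omega
  have h1 : (1 : ℝ) ≤ t := by exact_mod_cast ht
  have h2 : (t : ℝ) < K := by exact_mod_cast htK'
  have h3 : (K : ℝ) ≤ N := by exact_mod_cast hN
  have h4 : (0 : ℝ) < (K : ℝ) - t := by linarith
  have h5 : (0 : ℝ) < t := by linarith
  obtain ⟨m, hm⟩ : ∃ m : ℝ, m = M - 1 := ⟨_, rfl⟩
  have hm' : m = (N : ℝ) * t / ((K : ℝ) - t) + 1 / t := by rw [hm, hM]; ring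
  have hm0 : 0 < m := by
    rw [hm']; positivity
  have hq : ((N : ℝ) + m) * t ^ 2 - (m * K + 1) * t + K = 0 := by
    rw [hm']
    have := h4.ne'
    have := h5.ne'
    field_simp
    ring
  have hs : 0 ≤ 2 * ((N : ℝ) + m) * t - m * K - 1 := by
    have h6 : (2 * ((N : ℝ) + m) * t - m * K - 1) * t = (N + m) * t ^ 2 - K := by
      linear_combination hq
    have h7 : 0 ≤ (2 * ((N : ℝ) + m) * t - m * K - 1) * t := by
      rw [h6]
      have : (1 : ℝ) ≤ (t : ℝ) ^ 2 := one_le_pow₀ h1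
      nlinarith
    exact nonneg_of_mul_nonneg_left h7 h5
  have hsq : (m * K - 1) ^ 2 - 4 * K * N = (2 * ((N : ℝ) + m) * t - m * K - 1) ^ 2 := by
    linear_combination -4 * ((N : ℝ) + m) * hq
  have hNm : (0 : ℝ) < N + m := by linarith
  rw [← hm, hsq, Real.sqrt_sq hs, show (N : ℝ) + M - 1 = N + m by rw [hm]; ring,
    show 1 + m * (K : ℝ) + (2 * ((N : ℝ) + m) * t - m * K - 1) = 2 * (N + m) * t by ring]
  have := hNm.ne'
  field_simp
end

section
/- Let K, N, M be real numbers with K ≥ 2, N > 0, and M ≥ 2 + N/(K−1), and set V = √(((M−1)·K − 1)² − 4·K·N). Then 2·(N + (K+1)·(M−1)) / (1 + (M−1)·K + V) ≤ 5. Equivalently, the ratio of the centralized D2D secure rate R_T^C = 2K(N+M−1)/(1+(M−1)K+V) to the single-server secure multicast rate R_Multicast = K(N+M−1)/(N+(K+1)(M−1)) is at most the constant 5. -/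
/-- For real `K ≥ 2`, `N > 0`, `M ≥ 2 + N/(K−1)` and
`V = √(((M−1)·K − 1)² − 4·K·N)`, one has
`2·(N + (K+1)·(M−1)) / (1 + (M−1)·K + V) ≤ 5`, i.e. the ratio of the centralized
D2D secure rate to the single-server secure multicast rate is at most `5`. -/
theorem stmt7 (K N M : ℝ) (hK : 2 ≤ K) (hN : 0 < N) (hM : 2 + N / (K - 1) ≤ M)
    (V : ℝ) (hV : V = Real.sqrt (((M - 1) * K - 1) ^ 2 - 4 * K * N)) :
    2 * (N + (K + 1) * (M - 1)) / (1 + (M - 1) * K + V) ≤ 5 := by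
  have hV0 : 0 ≤ V := hV ▸ Real.sqrt_nonneg _
  have hK1 : 0 < K - 1 := by linarith
  have h0 : 0 < N / (K - 1) := div_pos hN hK1
  have hN' : N ≤ (M - 2) * (K - 1) := by
    rw [← div_le_iff₀ hK1]; linarith
  have hmK : 0 < (M - 1) * K := mul_pos (by linarith) (by linarith)
  rw [div_le_iff₀ (by linarith)]
  nlinarith
end

section
/- Let N, K be integers with K ≥ 2 and N ≥ K, and set M = N·(K−1) + K/(K−1) (a real number). Then ((M−1)·K−1)² − 4·K·N ≥ 0 and 2·K·(N+M−1) / (1 + (M−1)·K + √(((M−1)·K−1)² − 4·K·N)) = K/(K−1); that is, the centralized rate formula evaluated at the memory point corresponding to t = K−1 equals K/(K−1), matching the cut-set lower bound. -/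
/-- For integers `K ≥ 2`, `N ≥ K` and `M = N·(K−1) + K/(K−1)` (the memory point
corresponding to `t = K−1`), the discriminant `((M−1)·K−1)² − 4·K·N` is nonnegative
and the centralized rate formula equals `K/(K−1)`, matching the cut-set bound. -/
theorem stmt9 (N K : ℕ) (hK : 2 ≤ K) (hN : K ≤ N)
    (M : ℝ) (hM : M = (N : ℝ) * ((K : ℝ) - 1) + (K : ℝ) / ((K : ℝ) - 1)) :
    ((M - 1) * K - 1) ^ 2 - 4 * K * N ≥ 0 ∧
    2 * K * ((N : ℝ) + M - 1) /
        (1 + (M - 1) * K + Real.sqrt (((M - 1) * K - 1) ^ 2 - 4 * K * N)) =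
      (K : ℝ) / ((K : ℝ) - 1) := by
  have hk : (2 : ℝ) ≤ K := by exact_mod_cast hK
  have hn : (K : ℝ) ≤ N := by exact_mod_cast hN
  have ha : (0 : ℝ) < (K : ℝ) - 1 := by linarith
  have hne : (K : ℝ) - 1 ≠ 0 := ha.ne'
  have hD : ((M - 1) * K - 1) ^ 2 - 4 * K * N
      = ((N : ℝ) * (K - 1) * K - 1 / (K - 1)) ^ 2 := by
    rw [hM]; field_simp; ring
  have h1 : (1 : ℝ) / (K - 1) ≤ 1 := by
    rw [div_le_one ha]; linarith
  have h2 : (1 : ℝ) ≤ (N : ℝ) * (K - 1) := by nlinarith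
  have h3 : (1 : ℝ) ≤ (N : ℝ) * (K - 1) * K := by nlinarith
  refine ⟨by rw [hD]; positivity, ?_⟩
  rw [hD, Real.sqrt_sq (by linarith)]
  have hden : 1 + (M - 1) * K + ((N : ℝ) * (K - 1) * K - 1 / (K - 1))
      = 2 * ((N : ℝ) * (K - 1) * K + 1) := by
    rw [hM]; field_simp; ring
  have hpos : 2 * ((N : ℝ) * (K - 1) * K + 1) ≠ 0 := by
    have : 0 < 2 * ((N : ℝ) * (K - 1) * K + 1) := by linarith
    exact this.ne'
  rw [hden, div_eq_div_iff hpos hne, hM]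
  field_simp
  ring
end

section
/- Let N, K be integers with K ≥ 2 and N ≥ K, and define M(t) = N·t/(K−t) + 1/t + 1 as a real function of t. Then M is strictly increasing on the interval [1, K−1]: for all real t₁, t₂ with 1 ≤ t₁ < t₂ ≤ K−1 one has M(t₁) < M(t₂). -/
/-- For integers `K ≥ 2` and `N ≥ K`, the memory function
`M(t) = N·t/(K−t) + 1/t + 1` is strictly increasing on the real interval `[1, K−1]`. -/
theorem stmt13 (N K : ℕ) (hK : 2 ≤ K) (hN : K ≤ N) :
    ∀ t₁ t₂ : ℝ, 1 ≤ t₁ → t₁ < t₂ → t₂ ≤ (K : ℝ) - 1 →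
      (N : ℝ) * t₁ / ((K : ℝ) - t₁) + 1 / t₁ + 1 <
        (N : ℝ) * t₂ / ((K : ℝ) - t₂) + 1 / t₂ + 1 := by
  intro a b ha hab hb
  have hNK : (K : ℝ) ≤ N := by exact_mod_cast hN
  have hK0 : (2 : ℝ) ≤ K := by exact_mod_cast hK
  generalize (K : ℝ) = k at *
  generalize (N : ℝ) = n at *
  have h1 : 0 < k - a := by linarith
  have h2 : 0 < k - b := by linarith
  have ha0 : 0 < a := by linarith
  have hb0 : 0 < b := by linarith
  have e1 : (k - a) * (k - b) < k * k :=
    mul_lt_mul'' (by linarith) (by linarith) h1.le h2.le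
  have e2 : k * k ≤ n * k := mul_le_mul_of_nonneg_right hNK (by linarith)
  have hab1 : 1 ≤ a * b := one_le_mul_of_one_le_of_one_le ha (by linarith)
  have e3 : n * k ≤ n * k * (a * b) :=
    le_mul_of_one_le_right (mul_nonneg (by linarith) (by linarith)) hab1
  have key : 0 < (b - a) * (n * k * (a * b) - (k - a) * (k - b)) /
      ((k - a) * (k - b) * (a * b)) :=
    div_pos (mul_pos (by linarith) (by linarith)) (by positivity)
  have eq : (n * b / (k - b) + 1 / b + 1) - (n * a / (k - a) + 1 / a + 1) =
      (b - a) * (n * k * (a * b) - (k - a) * (k - b)) /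
      ((k - a) * (k - b) * (a * b)) := by
    have := h1.ne'
    have := h2.ne'
    field_simp
    ring
  linarith
end
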